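/- arXiv:1912.06531 — 8 statements merged into one kernel-verified Lean document; each statement's English description precedes it below -/
import Mathlib

section
/- Let x̄ be a local minimizer of problem (P). Assume that X is reflexive, that f is weakly sequentially lower semicontinuous in a neighborhood of x̄, and that condition (CC) holds. Then x̄ is an s-AKKT point of (P) (and thus also a w-AKKT point). -/
open Filter Topology MeasureTheory

section AKKTDefs

variable {X Y : Type*} [NormedAddCommGroup X] [NormedSpace ℝ X]
  [NormedAddCommGroup Y] [NormedSpace ℝ Y]

/-- The normal cone (in the sense of convex analysis) to `C` at `x`;
it is empty whenever `x ∉ C`. -/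
def normalCone (C : Set X) (x : X) : Set (X →L[ℝ] ℝ) :=
  {v | x ∈ C ∧ ∀ z ∈ C, v (z - x) ≤ 0}

/-- The polar cone of a set `A ⊆ X`, as a subset of the topological dual. -/
def polarCone (A : Set X) : Set (X →L[ℝ] ℝ) :=
  {v | ∀ x ∈ A, v x ≤ 0}

/-- The recession cone of `S`: all `d` with `d + S ⊆ S`. -/
def recessionCone (S : Set X) : Set X :=
  {d | ∀ x ∈ S, d + x ∈ S}

/-- The radial cone (cone of feasible directions) of `S` at `x0`. -/
def radialCone (S : Set X) (x0 : X) : Set X :=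
  {d | ∃ α : ℝ, 0 ≤ α ∧ ∃ x ∈ S, d = α • (x - x0)}

/-- Weak sequential convergence `x k ⇀ x0`. -/
def WeakSeqConv (x : ℕ → X) (x0 : X) : Prop :=
  ∀ φ : X →L[ℝ] ℝ, Tendsto (fun k => φ (x k)) atTop (𝓝 (φ x0))

/-- Weak-* sequential convergence of functionals `v k →* v0`. -/
def WeakStarSeqConv (v : ℕ → X →L[ℝ] ℝ) (v0 : X →L[ℝ] ℝ) : Prop :=
  ∀ z : X, Tendsto (fun k => v k z) atTop (𝓝 (v0 z))

/-- `r^k ↓ 0`: nonnegative, monotonically decreasing, converging to `0`. -/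
def DownTo0 (r : ℕ → ℝ) : Prop :=
  (∀ k, 0 ≤ r k) ∧ Antitone r ∧ Tendsto r atTop (𝓝 0)

/-- The (Bouligand) tangent cone to `Q` at `x0`. -/
def tangentCone (Q : Set X) (x0 : X) : Set X :=
  {d | ∃ (x : ℕ → X) (t : ℕ → ℝ), (∀ k, x k ∈ Q) ∧ (∀ k, 0 < t k) ∧ Antitone t ∧
    Tendsto t atTop (𝓝 0) ∧ Tendsto x atTop (𝓝 x0) ∧
    Tendsto (fun k => (t k)⁻¹ • (x k - x0)) atTop (𝓝 d)}

/-- The weak tangent cone to `Q` at `x0`. -/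
def weakTangentCone (Q : Set X) (x0 : X) : Set X :=
  {d | ∃ (x : ℕ → X) (t : ℕ → ℝ), (∀ k, x k ∈ Q) ∧ (∀ k, 0 < t k) ∧ Antitone t ∧
    Tendsto t atTop (𝓝 0) ∧ Tendsto x atTop (𝓝 x0) ∧
    WeakSeqConv (fun k => (t k)⁻¹ • (x k - x0)) d}

/-- The Clarke tangent cone to `Q` at `x0`. -/
def clarkeTangentCone (Q : Set X) (x0 : X) : Set X :=
  {d | ∀ (x : ℕ → X) (t : ℕ → ℝ), (∀ k, x k ∈ Q) → Tendsto x atTop (𝓝 x0) →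
    (∀ k, 0 < t k) → Antitone t → Tendsto t atTop (𝓝 0) →
    ∃ dk : ℕ → X, Tendsto dk atTop (𝓝 d) ∧ ∀ k, x k + t k • dk k ∈ Q}

/-- The Fréchet (regular) normal cone to `Q` at `x0`. -/
def frechetNormalCone (Q : Set X) (x0 : X) : Set (X →L[ℝ] ℝ) :=
  {v | ∀ ε > 0, ∃ δ > 0, ∀ x ∈ Q, ‖x - x0‖ ≤ δ → v (x - x0) ≤ ε * ‖x - x0‖}

/-- A normed space is reflexive if the canonical embedding into the double dual
is surjective. -/
def IsReflexiveSpace (Z : Type*) [NormedAddCommGroup Z] [NormedSpace ℝ Z] : Prop :=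
  Function.Surjective (NormedSpace.inclusionInDoubleDual ℝ Z)

/-- The set `M(x, r)` of inexact KKT multiples:
`M(x,r) = {G'(x)*λ + μ : μ ∈ N_C(x), ⟨λ, y - G(x)⟩ ≤ r ∀ y ∈ K}`. -/
def Mset (G : X → Y) (G' : X → X →L[ℝ] Y) (C : Set X) (K : Set Y)
    (x : X) (r : ℝ) : Set (X →L[ℝ] ℝ) :=
  {v | ∃ (l : Y →L[ℝ] ℝ) (μ : X →L[ℝ] ℝ), μ ∈ normalCone C x ∧
    (∀ y ∈ K, l (y - G x) ≤ r) ∧ v = l.comp (G' x) + μ}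

/-- KKT point of problem (P). -/
def KKTPoint (f' : X → X →L[ℝ] ℝ) (G : X → Y) (G' : X → X →L[ℝ] Y)
    (C : Set X) (K : Set Y) (x0 : X) : Prop :=
  ∃ l : Y →L[ℝ] ℝ, (-(f' x0) - l.comp (G' x0)) ∈ normalCone C x0 ∧
    l ∈ normalCone K (G x0)

/-- `x0` is an s-AKKT point: there is an s-AKKT sequence with `x k → x0` in norm. -/
def sAKKTPoint (f' : X → X →L[ℝ] ℝ) (G : X → Y) (G' : X → X →L[ℝ] Y)
    (C : Set X) (K : Set Y) (x0 : X) : Prop :=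
  ∃ (x : ℕ → X) (l : ℕ → Y →L[ℝ] ℝ) (ε : ℕ → X →L[ℝ] ℝ) (r : ℕ → ℝ),
    Tendsto ε atTop (𝓝 0) ∧ DownTo0 r ∧
    (∀ k, (ε k - f' (x k) - (l k).comp (G' (x k))) ∈ normalCone C (x k)) ∧
    (∀ k, ∀ y ∈ K, (l k) (y - G (x k)) ≤ r k) ∧
    Tendsto x atTop (𝓝 x0)

/-- `x0` is a w-AKKT point: there is a w-AKKT sequence with `x k ⇀ x0` weakly. -/
def wAKKTPoint (f' : X → X →L[ℝ] ℝ) (G : X → Y) (G' : X → X →L[ℝ] Y)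
    (C : Set X) (K : Set Y) (x0 : X) : Prop :=
  ∃ (x : ℕ → X) (l : ℕ → Y →L[ℝ] ℝ) (ε : ℕ → X →L[ℝ] ℝ) (r : ℕ → ℝ),
    WeakStarSeqConv ε 0 ∧ DownTo0 r ∧
    (∀ k, (ε k - f' (x k) - (l k).comp (G' (x k))) ∈ normalCone C (x k)) ∧
    (∀ k, ∀ y ∈ K, (l k) (y - G (x k)) ≤ r k) ∧
    WeakSeqConv x x0

/-- s-AKKT regularity at `x0`. -/
def sAKKTRegular (G : X → Y) (G' : X → X →L[ℝ] Y) (C : Set X) (K : Set Y)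
    (x0 : X) : Prop :=
  ∀ (v0 : X →L[ℝ] ℝ) (x : ℕ → X) (r : ℕ → ℝ) (v : ℕ → X →L[ℝ] ℝ),
    Tendsto x atTop (𝓝 x0) → DownTo0 r → Tendsto v atTop (𝓝 v0) →
    (∀ k, v k ∈ Mset G G' C K (x k) (r k)) → v0 ∈ Mset G G' C K x0 0

/-- sw-AKKT regularity at `x0`. -/
def swAKKTRegular (G : X → Y) (G' : X → X →L[ℝ] Y) (C : Set X) (K : Set Y)
    (x0 : X) : Prop :=
  ∀ (v0 : X →L[ℝ] ℝ) (x : ℕ → X) (r : ℕ → ℝ) (v : ℕ → X →L[ℝ] ℝ),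
    Tendsto x atTop (𝓝 x0) → DownTo0 r → WeakStarSeqConv v v0 →
    (∀ k, v k ∈ Mset G G' C K (x k) (r k)) → v0 ∈ Mset G G' C K x0 0

/-- w-AKKT regularity at `x0`. -/
def wAKKTRegular (G : X → Y) (G' : X → X →L[ℝ] Y) (C : Set X) (K : Set Y)
    (x0 : X) : Prop :=
  ∀ (v0 : X →L[ℝ] ℝ) (x : ℕ → X) (r : ℕ → ℝ) (v : ℕ → X →L[ℝ] ℝ),
    WeakSeqConv x x0 → DownTo0 r → WeakStarSeqConv v v0 →
    (∀ k, v k ∈ Mset G G' C K (x k) (r k)) → v0 ∈ Mset G G' C K x0 0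

/-- Condition (CC) from the paper. -/
def CondCC (G : X → Y) (C : Set X) (K : Set Y) : Prop :=
  ∀ (x : ℕ → X) (z : X), (∀ k, x k ∈ C) → z ∈ C → WeakSeqConv x z →
    Tendsto (fun k => Metric.infDist (G (x k)) K) atTop (𝓝 0) → G z ∈ K

end AKKTDefs

lemma aux_weak_closed {X : Type*} [NormedAddCommGroup X] [NormedSpace ℝ X]
    {S : Set X} (hcl : IsClosed S) (hcv : Convex ℝ S) {x : ℕ → X} {z : X}
    (hx : ∀ k, x k ∈ S) (hw : WeakSeqConv x z) : z ∈ S := by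
  by_contra hz
  obtain ⟨g, u, h1, h2⟩ := geometric_hahn_banach_closed_point hcv hcl hz
  have := le_of_tendsto (hw g) (Eventually.of_forall fun k => (h1 _ (hx k)).le)
  linarith

lemma aux_weak_subseq {X : Type*} [NormedAddCommGroup X] [NormedSpace ℝ X]
    (hrefl : IsReflexiveSpace X) (x : ℕ → X) (R : ℝ) (hx : ∀ k, ‖x k‖ ≤ R) :
    ∃ (z : X) (ψ : ℕ → ℕ), StrictMono ψ ∧ WeakSeqConv (x ∘ ψ) z := by
  set V : Submodule ℝ X := (Submodule.span ℝ (Set.range x)).topologicalClosure with hV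
  have hVx : ∀ k, x k ∈ V := fun k =>
    Submodule.le_topologicalClosure _ (Submodule.subset_span ⟨k, rfl⟩)
  have hVsep : TopologicalSpace.IsSeparable (V : Set X) := by
    have h := (Set.countable_range x).isSeparable.span (R := ℝ)
    exact h.closure
  have hVcl : IsClosed (V : Set X) := Submodule.isClosed_topologicalClosure _
  set B : Set X := (V : Set X) ∩ Metric.closedBall 0 R with hB
  have hBcl : IsClosed B := hVcl.inter Metric.isClosed_closedBall
  have hBcv : Convex ℝ B := V.convex.inter (convex_closedBall 0 R)
  set S : Set (WeakSpace ℝ X) := toWeakSpace ℝ X '' B with hS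
  have hScl : closure S = S := by
    rw [hS, ← hBcv.toWeakSpace_closure ℝ, hBcl.closure_eq]
  have hScomp : IsCompact S := by
    rw [← hScl]
    apply NormedSpace.isCompact_closure_of_isBounded
    · rw [hS, Set.preimage_image_eq _ (toWeakSpace ℝ X).injective]
      exact Metric.isBounded_closedBall.subset Set.inter_subset_right
    · intro w _
      obtain ⟨y, hy⟩ := hrefl (WeakDual.toStrongDual w)
      refine ⟨toWeakSpace ℝ X y, ?_⟩
      refine DFunLike.ext _ _ fun g => ?_
      have := congrArg (fun q => q g) hy
      exact this
  have hsep : ∃ φ : ℕ → X →L[ℝ] ℝ, ∀ v ∈ V, (∀ n, φ n v = 0) → v = 0 := by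
    obtain ⟨D, hDc, hDV⟩ := hVsep
    have hDne : D.Nonempty := by
      by_contra hne
      rw [Set.not_nonempty_iff_eq_empty] at hne
      have := hDV (V.zero_mem)
      simp [hne] at this
    obtain ⟨d, hd⟩ := hDc.exists_eq_range hDne
    choose φ hφ1 hφ2 using fun n => exists_dual_vector'' ℝ (d n)
    refine ⟨φ, fun v hv h0 => ?_⟩
    have hcl := hDV hv
    by_contra hne
    have hpos : 0 < ‖v‖ := norm_pos_iff.2 hne
    obtain ⟨w, hwD, hw⟩ := Metric.mem_closure_iff.1 hcl (‖v‖ / 2) (by positivity)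
    rw [hd] at hwD
    obtain ⟨n, rfl⟩ := hwD
    have h1 : ‖d n‖ ≤ ‖v - d n‖ := by
      have h2 : (φ n) (v - d n) = - ‖d n‖ := by
        rw [map_sub, h0 n, hφ2 n]; simp
      have h3 := (φ n).le_of_opNorm_le (hφ1 n) (v - d n)
      rw [h2] at h3
      simpa using h3
    have h4 : ‖v‖ ≤ ‖v - d n‖ + ‖d n‖ := by
      simpa using norm_add_le (v - d n) (d n)
    rw [dist_eq_norm] at hw
    linarith
  obtain ⟨φ, hφ⟩ := hsep
  have hev : ∀ g : X →L[ℝ] ℝ, Continuous (fun w : WeakSpace ℝ X => g ((toWeakSpace ℝ X).symm w)) :=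
    fun g => WeakBilin.eval_continuous (topDualPairing ℝ X).flip g
  have : CompactSpace S := isCompact_iff_compactSpace.mp hScomp
  have : TopologicalSpace.MetrizableSpace S := by
    refine Metric.PiNatEmbed.TopologicalSpace.MetrizableSpace.of_countable_separating
      (fun (n : ℕ) (w : S) => φ n ((toWeakSpace ℝ X).symm w.1))
      (fun n => (hev (φ n)).comp continuous_subtype_val) ?_
    rintro ⟨w, ⟨a, ha, rfl⟩⟩ ⟨w', ⟨b, hb, rfl⟩⟩ hne
    by_contra hcon
    push Not at hcon
    apply hne
    have : a - b = 0 := hφ _ (V.sub_mem ha.1 hb.1) (fun n => by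
      have := hcon n
      simp at this
      rw [map_sub, this, sub_self])
    simp [sub_eq_zero.1 this]
  obtain ⟨w, ψ, hψ, hlim⟩ := CompactSpace.tendsto_subseq
    (fun k => (⟨toWeakSpace ℝ X (x k), x k, ⟨hVx k, by simpa using hx k⟩, rfl⟩ : S))
  refine ⟨(toWeakSpace ℝ X).symm w.1, ψ, hψ, fun g => ?_⟩
  exact (((hev g).comp continuous_subtype_val).tendsto w).comp hlim

lemma aux_ekeland {X : Type*} [MetricSpace X] [CompleteSpace X] {S : Set X} (hS : IsClosed S)
    {φ : X → ℝ} (hφ : Continuous φ) {m : ℝ} (hm : ∀ x ∈ S, m ≤ φ x) {x0 : X} (hx0 : x0 ∈ S)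
    {e : ℝ} (he : 0 < e) :
    ∃ x ∈ S, φ x + e * dist x0 x ≤ φ x0 ∧ ∀ y ∈ S, φ x ≤ φ y + e * dist x y := by
  have hstep : ∀ (n : ℕ) (x : S), ∃ y : S, φ y + e * dist (x : X) y ≤ φ x ∧
      ∀ z ∈ S, φ z + e * dist (x : X) z ≤ φ x → φ y ≤ φ z + (1 / 2 : ℝ) ^ n := by
    intro n x
    set A : Set ℝ := φ '' {z | z ∈ S ∧ φ z + e * dist (x : X) z ≤ φ x}
    have hA : A.Nonempty := ⟨φ x, x, ⟨x.2, by simp⟩, rfl⟩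
    have hAb : BddBelow A := ⟨m, by rintro _ ⟨z, hz, rfl⟩; exact hm z hz.1⟩
    obtain ⟨_, ⟨y, hy, rfl⟩, hlt⟩ := exists_lt_of_csInf_lt hA
      (show sInf A < sInf A + (1 / 2 : ℝ) ^ n by linarith [show (0 : ℝ) < (1 / 2 : ℝ) ^ n by positivity])
    refine ⟨⟨y, hy.1⟩, hy.2, fun z hz hz2 => ?_⟩
    have := csInf_le hAb (⟨z, ⟨hz, hz2⟩, rfl⟩ : φ z ∈ A)
    simp only
    linarith
  choose F hF1 hF2 using hstep
  let s : ℕ → S := fun n => Nat.rec (motive := fun _ => S) ⟨x0, hx0⟩ (fun n x => F n x) n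
  have hs0 : (s 0 : X) = x0 := rfl
  have hs : ∀ n, s (n + 1) = F n (s n) := fun n => rfl
  have hT : ∀ n k, φ (s (n + k)) + e * dist (s n : X) (s (n + k)) ≤ φ (s n) := by
    intro n k
    induction k with
    | zero => simp
    | succ k ih =>
      have h1 := hF1 (n + k) (s (n + k))
      rw [← hs] at h1
      have h2 := dist_triangle (s n : X) (s (n + k)) (s (n + k + 1))
      have h3 := mul_le_mul_of_nonneg_left h2 he.le
      rw [← add_assoc]
      linarith
  have hanti : Antitone (fun n => φ (s n)) := by
    apply antitone_nat_of_succ_le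
    intro n
    have := hT n 1
    have h2 : 0 ≤ e * dist (s n : X) (s (n + 1)) := by positivity
    linarith
  have hlim := tendsto_atTop_ciInf hanti ⟨m, by rintro _ ⟨n, rfl⟩; exact hm _ (s n).2⟩
  set L := ⨅ n, φ (s n)
  have hLle : ∀ n, L ≤ φ (s n) := fun n =>
    ciInf_le ⟨m, by rintro _ ⟨n, rfl⟩; exact hm _ (s n).2⟩ n
  have hcau : CauchySeq (fun n => (s n : X)) := by
    refine cauchySeq_of_le_tendsto_0' (fun n => (φ (s n) - L) / e) ?_ ?_
    · intro n k hnk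
      obtain ⟨j, rfl⟩ := Nat.exists_eq_add_of_le hnk
      rw [le_div_iff₀ he]
      have := hT n j
      have := hLle (n + j)
      linarith
    · have := (hlim.sub_const L).div_const e
      simpa using this
  obtain ⟨x, hx⟩ := cauchySeq_tendsto_of_complete hcau
  have hxS : x ∈ S := hS.mem_of_tendsto hx (Eventually.of_forall fun n => (s n).2)
  have hφx : Tendsto (fun n => φ (s n)) atTop (𝓝 (φ x)) := (hφ.tendsto x).comp hx
  have hxT : ∀ n, φ x + e * dist (s n : X) x ≤ φ (s n) := by
    intro n
    have h1 : Tendsto (fun k => φ (s k) + e * dist (s n : X) (s k)) atTop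
        (𝓝 (φ x + e * dist (s n : X) x)) :=
      hφx.add ((tendsto_const_nhds.dist hx).const_mul e)
    refine le_of_tendsto h1 ?_
    filter_upwards [eventually_ge_atTop n] with k hk
    obtain ⟨j, rfl⟩ := Nat.exists_eq_add_of_le hk
    exact hT n j
  refine ⟨x, hxS, by simpa [hs0] using hxT 0, fun y hy => ?_⟩
  by_contra hcon
  push Not at hcon
  have hyx : φ x ≤ φ y := by
    have h1 : Tendsto (fun n => φ y + (1 / 2 : ℝ) ^ n) atTop (𝓝 (φ y + 0)) :=
      (tendsto_pow_atTop_nhds_zero_of_lt_one (by norm_num) (by norm_num)).const_add _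
    rw [add_zero] at h1
    refine le_of_tendsto_of_tendsto' (hφx.comp (tendsto_add_atTop_nat 1)) h1 fun n => ?_
    have h2 := hF2 n (s n) y hy (by
      have h3 := hxT n
      have h4 := mul_le_mul_of_nonneg_left (dist_triangle (s n : X) x y) he.le
      linarith)
    rw [← hs] at h2
    exact h2
  have : 0 ≤ e * dist x y := by positivity
  linarith

lemma aux_infDist_convex {Y : Type*} [NormedAddCommGroup Y] [NormedSpace ℝ Y] {K : Set Y}
    (hne : K.Nonempty) (hK : Convex ℝ K) : ConvexOn ℝ Set.univ (fun y => Metric.infDist y K) := by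
  refine ⟨convex_univ, fun a _ b _ s t hs ht hst => ?_⟩
  simp only [smul_eq_mul]
  refine le_of_forall_pos_le_add fun η hη => ?_
  obtain ⟨u, hu, hu2⟩ := (Metric.infDist_lt_iff (x := a) hne).1 (lt_add_of_pos_right (Metric.infDist a K) hη)
  obtain ⟨v, hv, hv2⟩ := (Metric.infDist_lt_iff (x := b) hne).1 (lt_add_of_pos_right (Metric.infDist b K) hη)
  have h1 := Metric.infDist_le_dist_of_mem (x := s • a + t • b) (hK hu hv hs ht hst)
  have h2 : dist (s • a + t • b) (s • u + t • v) ≤ s * dist a u + t * dist b v := by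
    refine (dist_add_add_le _ _ _ _).trans ?_
    rw [dist_smul₀, dist_smul₀, Real.norm_of_nonneg hs, Real.norm_of_nonneg ht]
  have h3 := mul_le_mul_of_nonneg_left hu2.le hs
  have h4 := mul_le_mul_of_nonneg_left hv2.le ht
  have h5 : s * η + t * η = η := by rw [← add_mul, hst, one_mul]
  linarith

lemma aux_sep {X Y : Type*} [NormedAddCommGroup X] [NormedSpace ℝ X]
    [NormedAddCommGroup Y] [NormedSpace ℝ Y] {p : Y → ℝ} (hp : ConvexOn ℝ Set.univ p)
    (hpc : Continuous p) {c : ℝ} (hc : 0 ≤ c) (A : X →L[ℝ] Y) (a : X →L[ℝ] ℝ) {C : Set X}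
    (hC : Convex ℝ C) {x : X} (hx : x ∈ C) (y0 : Y)
    (H : ∀ z ∈ C, 0 ≤ a (z - x) + (p (y0 + A (z - x)) - p y0) + c * ‖z - x‖) :
    ∃ (α : X →L[ℝ] ℝ) (β : Y →L[ℝ] ℝ), ‖α‖ ≤ c ∧ (∀ y, β (y - y0) ≤ p y - p y0) ∧
      ∀ z ∈ C, 0 ≤ α (z - x) + β (A (z - x)) + a (z - x) := by
  let q : X × Y → ℝ := fun w => p (y0 + w.2) - p y0 + c * ‖w.1‖
  have hqc : Continuous q := by fun_prop
  have hq : ConvexOn ℝ Set.univ q := by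
    refine ⟨convex_univ, fun u _ v _ s t hs ht hst => ?_⟩
    have h1 := hp.2 (Set.mem_univ (y0 + u.2)) (Set.mem_univ (y0 + v.2)) hs ht hst
    have h2 : s • (y0 + u.2) + t • (y0 + v.2) = y0 + (s • u + t • v).2 := by
      have : y0 = s • y0 + t • y0 := by rw [← add_smul, hst, one_smul]
      conv_rhs => rw [this]
      simp only [smul_add, Prod.snd_add, Prod.smul_snd]; abel
    rw [h2] at h1
    have h3 : ‖(s • u + t • v).1‖ ≤ s * ‖u.1‖ + t * ‖v.1‖ := by
      refine (norm_add_le _ _).trans ?_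
      simp [norm_smul, abs_of_nonneg hs, abs_of_nonneg ht]
    have h4 := mul_le_mul_of_nonneg_left h3 hc
    have h5 : p y0 = s * p y0 + t * p y0 := by rw [← add_mul, hst, one_mul]
    simp only [smul_eq_mul, q] at h1 ⊢
    linarith
  let E : Set ((X × Y) × ℝ) := {w | q w.1 < w.2}
  have hEo : IsOpen E := isOpen_lt (by fun_prop) (by fun_prop)
  have hEc : Convex ℝ E := by
    have := hq.convex_strict_epigraph
    simpa [E] using this
  let T : Set ((X × Y) × ℝ) := {w | w.1.1 + x ∈ C ∧ w.1.2 = A w.1.1 ∧ w.2 = - a w.1.1}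
  have hTc : Convex ℝ T := by
    rintro ⟨⟨u1, u2⟩, u3⟩ ⟨hu1, hu2, hu3⟩ ⟨⟨v1, v2⟩, v3⟩ ⟨hv1, hv2, hv3⟩ s t hs ht hst
    simp only at hu1 hu2 hu3 hv1 hv2 hv3
    subst hu2 hu3 hv2 hv3
    refine ⟨?_, ?_, ?_⟩
    · have := hC hu1 hv1 hs ht hst
      have h2 : s • (u1 + x) + t • (v1 + x) = s • u1 + t • v1 + x := by
        have : x = s • x + t • x := by rw [← add_smul, hst, one_smul]
        conv_rhs => rw [this]
        simp only [smul_add]; abel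
      rw [h2] at this
      simpa using this
    · simp
    · simp; ring
  have hdis : Disjoint E T := by
    rw [Set.disjoint_left]
    rintro ⟨⟨u1, u2⟩, u3⟩ hE ⟨hu1, hu2, hu3⟩
    simp only at hu1 hu2 hu3
    subst hu2 hu3
    have := H _ hu1
    simp only [add_sub_cancel_right] at this
    simp only [E, q, Set.mem_ofPred_eq] at hE
    linarith
  obtain ⟨Φ, u, h1, h2⟩ := geometric_hahn_banach_open hEc hEo hTc hdis
  let α0 : X →L[ℝ] ℝ := Φ.comp ((ContinuousLinearMap.inl ℝ (X × Y) ℝ).comp (ContinuousLinearMap.inl ℝ X Y))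
  let β0 : Y →L[ℝ] ℝ := Φ.comp ((ContinuousLinearMap.inl ℝ (X × Y) ℝ).comp (ContinuousLinearMap.inr ℝ X Y))
  let γ : ℝ := Φ ((0, 0), 1)
  have hΦ : ∀ h v τ, Φ ((h, v), τ) = α0 h + β0 v + τ * γ := by
    intro h v τ
    have : (((h, v), τ) : (X × Y) × ℝ) = ((h, 0), 0) + ((0, v), 0) + τ • ((0, 0), 1) := by
      simp
    rw [this, map_add, map_add, map_smul]
    simp [α0, β0, γ]
  have hE : ∀ h v τ, q (h, v) < τ → α0 h + β0 v + τ * γ < u := by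
    intro h v τ hlt
    rw [← hΦ]
    exact h1 _ hlt
  have hT : ∀ h, h + x ∈ C → u ≤ α0 h + β0 (A h) - a h * γ := by
    intro h hh
    have := h2 ((h, A h), - a h) ⟨hh, rfl, rfl⟩
    rw [hΦ] at this
    linarith
  have hq0 : q (0, 0) = 0 := by simp [q]
  have hu0 : u ≤ 0 := by simpa using hT 0 (by simpa using hx)
  have hγ : γ < 0 := by
    have := hE 0 0 1 (by rw [hq0]; norm_num)
    simp at this
    linarith
  have hEle : ∀ h v, α0 h + β0 v + q (h, v) * γ ≤ u := by
    intro h v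
    have ht : Tendsto (fun τ : ℝ => α0 h + β0 v + τ * γ) (𝓝[>] (q (h, v)))
        (𝓝 (α0 h + β0 v + q (h, v) * γ)) := by
      have : Continuous (fun τ : ℝ => α0 h + β0 v + τ * γ) := by fun_prop
      exact (this.tendsto _).mono_left nhdsWithin_le_nhds
    refine le_of_tendsto ht ?_
    filter_upwards [self_mem_nhdsWithin] with τ hτ
    exact (hE h v τ hτ).le
  have hu : u = 0 := by
    have := hEle 0 0
    rw [hq0] at this
    simp at this
    linarith
  subst hu
  have hk : 0 < (-γ)⁻¹ := by
    rw [inv_pos]; linarith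
  have hkγ : (-γ)⁻¹ * γ = -1 := by
    rw [inv_neg, neg_mul, inv_mul_cancel₀ hγ.ne]
  have hab : ∀ h v, ((-γ)⁻¹ • α0) h + ((-γ)⁻¹ • β0) v ≤ q (h, v) := by
    intro h v
    have h3 := mul_le_mul_of_nonneg_left (hEle h v) hk.le
    have h4 : (-γ)⁻¹ * (α0 h + β0 v + q (h, v) * γ) =
      (-γ)⁻¹ * α0 h + (-γ)⁻¹ * β0 v + q (h, v) * ((-γ)⁻¹ * γ) := by ring
    rw [h4, hkγ] at h3
    simp only [smul_apply, smul_eq_mul]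
    linarith
  refine ⟨(-γ)⁻¹ • α0, (-γ)⁻¹ • β0, ?_, ?_, ?_⟩
  · refine ContinuousLinearMap.opNorm_le_bound _ hc fun h => ?_
    rw [Real.norm_eq_abs, abs_le]
    have h3 := hab h 0
    have h4 := hab (-h) 0
    simp only [q, map_zero, map_neg, norm_neg, add_zero, sub_self, zero_add] at h3 h4
    constructor <;> linarith
  · intro y
    have h3 := hab 0 (y - y0)
    simpa [q] using h3
  · intro z hz
    have h3 := mul_le_mul_of_nonneg_left (hT (z - x) (by simpa using hz)) hk.le
    have h4 : (-γ)⁻¹ * (α0 (z - x) + β0 (A (z - x)) - a (z - x) * γ) =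
      (-γ)⁻¹ * α0 (z - x) + (-γ)⁻¹ * β0 (A (z - x)) - a (z - x) * ((-γ)⁻¹ * γ) := by ring
    rw [h4, hkγ] at h3
    simp only [smul_apply, smul_eq_mul]
    linarith

lemma aux_first_order {X Y : Type*} [NormedAddCommGroup X] [NormedSpace ℝ X]
    [NormedAddCommGroup Y] [NormedSpace ℝ Y] {f : X → ℝ} {a : X →L[ℝ] ℝ} {G : X → Y}
    {A : X →L[ℝ] Y} {x xb : X} (hf : HasFDerivAt f a x) (hG : HasFDerivAt G A x)
    {K : Set Y} (hKne : K.Nonempty) (hK : Convex ℝ K) {C : Set X} (hC : Convex ℝ C) (hx : x ∈ C)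
    {k η : ℝ} (hk : 0 ≤ k)
    (hloc : ∀ᶠ y in 𝓝 x, y ∈ C → f x + k * Metric.infDist (G x) K + ‖x - xb‖ ^ 2 ≤
      f y + k * Metric.infDist (G y) K + ‖y - xb‖ ^ 2 + η * ‖y - x‖) :
    ∀ z ∈ C, 0 ≤ a (z - x) + (k * Metric.infDist (G x + A (z - x)) K - k * Metric.infDist (G x) K)
      + (2 * ‖x - xb‖ + η) * ‖z - x‖ := by
  intro z hz
  set h := z - x with hh
  have s1 := (hf.hasLineDerivAt h).tendsto_slope_zero_right
  have s2 := (hG.hasLineDerivAt h).tendsto_slope_zero_right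
  have s3 := ((s2.sub_const (A h)).norm).const_mul k
  simp only [sub_self, norm_zero, mul_zero] at s3
  have s4 : Tendsto (fun t : ℝ => t * ‖h‖ ^ 2) (𝓝[>] 0) (𝓝 0) := by
    have : Continuous (fun t : ℝ => t * ‖h‖ ^ 2) := by fun_prop
    have := (this.tendsto 0).mono_left (nhdsWithin_le_nhds (s := Set.Ioi 0))
    simpa using this
  have s5 := ((s1.add s3).add s4).add_const
    ((k * Metric.infDist (G x + A h) K - k * Metric.infDist (G x) K)
      + (2 * ‖x - xb‖ + η) * ‖h‖)
  rw [add_zero, add_zero, ← add_assoc] at s5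
  refine ge_of_tendsto s5 ?_
  have hcont : Tendsto (fun t : ℝ => x + t • h) (𝓝[>] 0) (𝓝 x) := by
    have : Continuous (fun t : ℝ => x + t • h) := by fun_prop
    have := (this.tendsto 0).mono_left (nhdsWithin_le_nhds (s := Set.Ioi 0))
    simpa using this
  filter_upwards [hcont.eventually hloc, self_mem_nhdsWithin,
    Ioo_mem_nhdsGT (show (0 : ℝ) < 1 by norm_num)] with t ht ht0 ht1
  have ht0 : 0 < t := ht0
  have hmem : x + t • h ∈ C := by
    have := hC hx hz (by linarith [ht1.2] : (0 : ℝ) ≤ 1 - t) ht0.le (by ring)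
    convert this using 1
    rw [hh]; module
  have e1 := ht hmem
  have e2 : ‖x + t • h - x‖ = t * ‖h‖ := by
    rw [add_sub_cancel_left, norm_smul, Real.norm_of_nonneg ht0.le]
  have e3 : ‖x + t • h - xb‖ ≤ ‖x - xb‖ + t * ‖h‖ := by
    have := norm_add_le (x - xb) (t • h)
    rw [norm_smul, Real.norm_of_nonneg ht0.le] at this
    rwa [← add_sub_right_comm] at this
  have e4 : ‖x + t • h - xb‖ ^ 2 ≤ (‖x - xb‖ + t * ‖h‖) ^ 2 :=
    pow_le_pow_left₀ (norm_nonneg _) e3 2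
  have e5 : Metric.infDist (G (x + t • h)) K ≤ Metric.infDist (G x + t • A h) K
      + t * ‖t⁻¹ • (G (x + t • h) - G x) - A h‖ := by
    have := Metric.infDist_le_infDist_add_dist (s := K) (x := G (x + t • h)) (y := G x + t • A h)
    refine this.trans_eq ?_
    congr 1
    rw [dist_eq_norm]
    have key : ∀ g g0 w : Y, g - (g0 + t • w) = t • (t⁻¹ • (g - g0) - w) := by
      intro g g0 w
      rw [smul_sub t, smul_smul, mul_inv_cancel₀ ht0.ne', one_smul]; abel
    rw [key, norm_smul, Real.norm_of_nonneg ht0.le]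
  have e6 : Metric.infDist (G x + t • A h) K ≤ (1 - t) * Metric.infDist (G x) K +
      t * Metric.infDist (G x + A h) K := by
    have := (aux_infDist_convex hKne hK).2 (Set.mem_univ (G x)) (Set.mem_univ (G x + A h))
      (by linarith [ht1.2] : (0 : ℝ) ≤ 1 - t) ht0.le (by ring)
    have key : (1 - t) • G x + t • (G x + A h) = G x + t • A h := by module
    rw [key] at this
    exact this
  have e7 := mul_le_mul_of_nonneg_left (e5.trans (add_le_add_left e6 _)) hk
  rw [e2] at e1
  simp only [smul_eq_mul]
  refine nonneg_of_mul_nonneg_right (a := t) ?_ ht0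
  have e8 : t * (t⁻¹ * (f (x + t • h) - f x)) = f (x + t • h) - f x := by
    field_simp
  simp only [mul_add, e8]
  nlinarith [e1, e4, e7]

theorem stmt_2 {X Y : Type*} [NormedAddCommGroup X] [NormedSpace ℝ X] [CompleteSpace X]
    [NormedAddCommGroup Y] [NormedSpace ℝ Y] [CompleteSpace Y]
    (hrefl : IsReflexiveSpace X)
    (f : X → ℝ) (f' : X → X →L[ℝ] ℝ)
    (hfd : ∀ x, HasFDerivAt f (f' x) x) (hfc : Continuous f')
    (G : X → Y) (G' : X → X →L[ℝ] Y)
    (hGd : ∀ x, HasFDerivAt G (G' x) x) (hGc : Continuous G')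
    (C : Set X) (K : Set Y)
    (hCne : C.Nonempty) (hCcl : IsClosed C) (hCcv : Convex ℝ C)
    (hKne : K.Nonempty) (hKcl : IsClosed K) (hKcv : Convex ℝ K)
    (xbar : X) (hxC : xbar ∈ C) (hxK : G xbar ∈ K)
    (hlsc : ∃ U ∈ 𝓝 xbar, ∀ (x : ℕ → X) (z : X), (∀ k, x k ∈ U) → z ∈ U →
      WeakSeqConv x z → ∀ c : ℝ, c < f z → ∀ᶠ k in atTop, c < f (x k))
    (hCC : CondCC G C K)
    (hmin : ∃ ε > (0 : ℝ), ∀ x ∈ C, G x ∈ K → ‖x - xbar‖ ≤ ε → f xbar ≤ f x) :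
    sAKKTPoint f' G G' C K xbar ∧ wAKKTPoint f' G G' C K xbar := by

  obtain ⟨U, hU, hlsc⟩ := hlsc
  obtain ⟨ε0, hε0, hmin⟩ := hmin
  obtain ⟨δ0, hδ0, hδU⟩ := Metric.nhds_basis_closedBall.mem_iff.1 hU
  set δ := min δ0 ε0 with hδdef
  have hδ : 0 < δ := lt_min hδ0 hε0
  set S : Set X := C ∩ Metric.closedBall xbar δ with hS
  have hScl : IsClosed S := hCcl.inter Metric.isClosed_closedBall
  have hScv : Convex ℝ S := hCcv.inter (convex_closedBall xbar δ)
  have hSU : ∀ x ∈ S, x ∈ U := fun x hx =>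
    hδU (Metric.closedBall_subset_closedBall (min_le_left _ _) hx.2)
  have hxS : xbar ∈ S := ⟨hxC, Metric.mem_closedBall_self hδ.le⟩
  have hsub : ∀ x : ℕ → X, (∀ k, x k ∈ S) →
      ∃ z ∈ S, ∃ ψ : ℕ → ℕ, StrictMono ψ ∧ WeakSeqConv (x ∘ ψ) z := by
    intro x hx
    obtain ⟨z, ψ, hψ, hw⟩ := aux_weak_subseq hrefl x (δ + ‖xbar‖) (fun k => by
      have h1 := (hx k).2
      rw [mem_closedBall_iff_norm] at h1
      have h2 := norm_add_le (x k - xbar) xbar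
      rw [sub_add_cancel] at h2
      linarith)
    exact ⟨z, aux_weak_closed hScl hScv (fun k => hx (ψ k)) hw, ψ, hψ, hw⟩
  -- boundedness below
  obtain ⟨m, hm⟩ : ∃ m : ℝ, ∀ x ∈ S, m ≤ f x := by
    by_contra hcon
    push Not at hcon
    choose x hx hfx using fun n : ℕ => hcon (-(n : ℝ))
    obtain ⟨z, hz, ψ, hψ, hw⟩ := hsub x hx
    have h1 := hlsc (x ∘ ψ) z (fun k => hSU _ (hx _)) (hSU z hz) hw (f z - 1) (by linarith)
    obtain ⟨N, hN⟩ := exists_nat_gt (-(f z - 1))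
    obtain ⟨k, hk1, hk2⟩ := (h1.and (eventually_ge_atTop N)).exists
    have h2 := hfx (ψ k)
    have h3 : (N : ℝ) ≤ (ψ k : ℝ) := by exact_mod_cast hk2.trans (hψ.id_le k)
    simp only [Function.comp] at hk1
    linarith
  have hfcont : Continuous f := continuous_iff_continuousAt.2 fun x => (hfd x).continuousAt
  have hGcont : Continuous G := continuous_iff_continuousAt.2 fun x => (hGd x).continuousAt
  have hdcont : Continuous (fun y : Y => Metric.infDist y K) := Metric.continuous_infDist_pt K
  have hek : ∀ n : ℕ, ∃ x ∈ S,
      f x + n * Metric.infDist (G x) K + ‖x - xbar‖ ^ 2 ≤ f xbar ∧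
      ∀ y ∈ S, f x + n * Metric.infDist (G x) K + ‖x - xbar‖ ^ 2 ≤
        f y + n * Metric.infDist (G y) K + ‖y - xbar‖ ^ 2 + (1 / ((n : ℝ) + 1)) * ‖y - x‖ := by
    intro n
    have he : (0 : ℝ) < 1 / ((n : ℝ) + 1) := by positivity
    obtain ⟨x, hx, h1, h2⟩ := aux_ekeland hScl
      (φ := fun x => f x + n * Metric.infDist (G x) K + ‖x - xbar‖ ^ 2)
      (by have := hdcont.comp hGcont
          exact (hfcont.add (this.const_mul _)).add (by fun_prop)) (m := m)
      (fun x hx => by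
        have h1 := hm x hx
        have h2 : 0 ≤ (n : ℝ) * Metric.infDist (G x) K :=
          mul_nonneg (Nat.cast_nonneg _) Metric.infDist_nonneg
        have h3 : 0 ≤ ‖x - xbar‖ ^ 2 := by positivity
        linarith) hxS he
    refine ⟨x, hx, ?_, fun y hy => ?_⟩
    · have h3 : 0 ≤ 1 / ((n : ℝ) + 1) * dist xbar x := by positivity
      simp only [Metric.infDist_zero_of_mem hxK, sub_self, norm_zero] at h1
      norm_num at h1 h3 ⊢
      linarith
    · have := h2 y hy
      rwa [dist_comm, dist_eq_norm] at this
  choose x hxS' hx1 hx2 using hek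
  -- infeasibility tends to zero
  have hdist : Tendsto (fun n => Metric.infDist (G (x n)) K) atTop (𝓝 0) := by
    have hlim : Tendsto (fun n : ℕ => (f xbar - m) / (n : ℝ)) atTop (𝓝 0) :=
      tendsto_const_div_atTop_nhds_zero_nat _
    refine tendsto_of_tendsto_of_tendsto_of_le_of_le' tendsto_const_nhds hlim
      (Eventually.of_forall fun n => Metric.infDist_nonneg) ?_
    filter_upwards [eventually_gt_atTop 0] with n hn
    have hn' : (0 : ℝ) < n := by exact_mod_cast hn
    rw [le_div_iff₀ hn']
    have h1 := hx1 n
    have h2 := hm _ (hxS' n)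
    have h3 : 0 ≤ ‖x n - xbar‖ ^ 2 := by positivity
    linarith
  have hconv : Tendsto x atTop (𝓝 xbar) := by
    refine tendsto_of_subseq_tendsto fun ns hns => ?_
    obtain ⟨z, hz, ψ, hψ, hw⟩ := hsub (x ∘ ns) (fun k => hxS' _)
    refine ⟨ψ, ?_⟩
    have hnsψ : Tendsto (fun k => ns (ψ k)) atTop atTop := hns.comp hψ.tendsto_atTop
    have hzK : G z ∈ K := hCC _ z (fun k => (hxS' _).1) hz.1 hw (hdist.comp hnsψ)
    have hfz : f xbar ≤ f z := hmin z hz.1 hzK (by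
      have := mem_closedBall_iff_norm.1 hz.2
      exact this.trans (min_le_right _ _))
    rw [tendsto_iff_norm_sub_tendsto_zero, Metric.tendsto_atTop]
    intro η hη
    have h1 := hlsc _ z (fun k => hSU _ (hxS' (ns (ψ k)))) (hSU z hz) hw (f z - η ^ 2)
      (by have : 0 < η ^ 2 := by positivity
          linarith)
    obtain ⟨N, hN⟩ := eventually_atTop.1 h1
    refine ⟨N, fun k hk => ?_⟩
    have h2 : f z - η ^ 2 < f (x (ns (ψ k))) := hN k hk
    have h3 := hx1 (ns (ψ k))
    have h4 : 0 ≤ (ns (ψ k) : ℝ) * Metric.infDist (G (x (ns (ψ k)))) K :=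
      mul_nonneg (Nat.cast_nonneg _) Metric.infDist_nonneg
    have h5 : ‖x (ns (ψ k)) - xbar‖ ^ 2 < η ^ 2 := by linarith
    have h6 := lt_of_pow_lt_pow_left₀ 2 hη.le h5
    simpa using h6
  -- multipliers
  obtain ⟨N, hN⟩ := eventually_atTop.1 (hconv.eventually (Metric.ball_mem_nhds xbar hδ))
  have hmul : ∀ k : ℕ, ∃ (α : X →L[ℝ] ℝ) (β : Y →L[ℝ] ℝ),
      ‖α‖ ≤ 2 * ‖x (k + N) - xbar‖ + 1 / (((k + N : ℕ) : ℝ) + 1) ∧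
      (∀ y ∈ K, β (y - G (x (k + N))) ≤ 0) ∧
      ∀ z ∈ C, 0 ≤ α (z - x (k + N)) + β (G' (x (k + N)) (z - x (k + N)))
        + f' (x (k + N)) (z - x (k + N)) := by
    intro k
    have hball : x (k + N) ∈ Metric.ball xbar δ := hN _ (Nat.le_add_left _ _)
    have hfo := aux_first_order (hfd (x (k + N))) (hGd (x (k + N))) (xb := xbar) hKne hKcv hCcv
      (hxS' (k + N)).1 (Nat.cast_nonneg (k + N)) (η := 1 / (((k + N : ℕ) : ℝ) + 1)) (by
        filter_upwards [Metric.isOpen_ball.mem_nhds hball] with y hy hyC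
        exact hx2 (k + N) y ⟨hyC, Metric.ball_subset_closedBall hy⟩)
    obtain ⟨α, β, h1, h2, h3⟩ := aux_sep
      (p := fun y => ((k + N : ℕ) : ℝ) * Metric.infDist y K)
      ((aux_infDist_convex hKne hKcv).smul (Nat.cast_nonneg (k + N))) (hdcont.const_mul _)
      (by positivity) (G' (x (k + N))) (f' (x (k + N))) hCcv (hxS' (k + N)).1 (G (x (k + N))) hfo
    refine ⟨α, β, h1, fun y hy => ?_, h3⟩
    have h4 := h2 y
    have h5 : 0 ≤ ((k + N : ℕ) : ℝ) * Metric.infDist (G (x (k + N))) K :=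
      mul_nonneg (Nat.cast_nonneg _) Metric.infDist_nonneg
    simp only [Metric.infDist_zero_of_mem hy, mul_zero] at h4
    linarith
  choose α β hα hβ hαβ using hmul
  have hxt : Tendsto (fun k => x (k + N)) atTop (𝓝 xbar) := hconv.comp (tendsto_add_atTop_nat N)
  have hεt : Tendsto (fun k => - α k) atTop (𝓝 0) := by
    rw [tendsto_zero_iff_norm_tendsto_zero]
    have h1 : Tendsto (fun k => 2 * ‖x (k + N) - xbar‖ + 1 / (((k + N : ℕ) : ℝ) + 1)) atTop
        (𝓝 (2 * 0 + 0)) :=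
      ((tendsto_iff_norm_sub_tendsto_zero.1 hxt).const_mul 2).add
        (tendsto_one_div_add_atTop_nhds_zero_nat.comp (tendsto_add_atTop_nat N))
    rw [mul_zero, add_zero] at h1
    refine squeeze_zero (fun k => norm_nonneg _) (fun k => ?_) h1
    rw [norm_neg]
    exact hα k
  have hr : DownTo0 (fun _ => (0 : ℝ)) :=
    ⟨fun _ => le_rfl, fun _ _ _ => le_rfl, tendsto_const_nhds⟩
  have hcone : ∀ k, (- α k - f' (x (k + N)) - (β k).comp (G' (x (k + N)))) ∈
      normalCone C (x (k + N)) := by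
    intro k
    refine ⟨(hxS' _).1, fun z hz => ?_⟩
    have := hαβ k z hz
    change - α k (z - x (k + N)) - f' (x (k + N)) (z - x (k + N))
      - β k (G' (x (k + N)) (z - x (k + N))) ≤ 0
    linarith
  refine ⟨⟨fun k => x (k + N), β, fun k => - α k, fun _ => 0, hεt, hr, hcone, hβ, hxt⟩,
    ⟨fun k => x (k + N), β, fun k => - α k, fun _ => 0, ?_, hr, hcone, hβ, ?_⟩⟩
  · intro z
    exact ((ContinuousLinearMap.apply ℝ ℝ z).continuous.tendsto 0).comp hεt
  · intro g
    exact (g.continuous.tendsto xbar).comp hxt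
end

section
/- Let x̄ ∈ F be a feasible point of problem (P). If x̄ is an s-AKKT point and x̄ is s-AKKT regular, then x̄ is a KKT point of (P). -/
open Filter Topology MeasureTheory

theorem stmt_3 {X Y : Type*} [NormedAddCommGroup X] [NormedSpace ℝ X] [CompleteSpace X]
    [NormedAddCommGroup Y] [NormedSpace ℝ Y] [CompleteSpace Y]
    (f : X → ℝ) (f' : X → X →L[ℝ] ℝ)
    (hfd : ∀ x, HasFDerivAt f (f' x) x) (hfc : Continuous f')
    (G : X → Y) (G' : X → X →L[ℝ] Y)
    (hGd : ∀ x, HasFDerivAt G (G' x) x) (hGc : Continuous G')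
    (C : Set X) (K : Set Y)
    (hCne : C.Nonempty) (hCcl : IsClosed C) (hCcv : Convex ℝ C)
    (hKne : K.Nonempty) (hKcl : IsClosed K) (hKcv : Convex ℝ K)
    (xbar : X) (hxC : xbar ∈ C) (hxK : G xbar ∈ K)
    (hpt : sAKKTPoint f' G G' C K xbar)
    (hreg : sAKKTRegular G G' C K xbar) :
    KKTPoint f' G G' C K xbar := by
  obtain ⟨x, l, ε, r, hε, hr, hN, hK, hx⟩ := hpt
  have hv : Tendsto (fun k => ε k - f' (x k)) atTop (𝓝 (-(f' xbar))) := by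
    simpa using hε.sub ((hfc.tendsto xbar).comp hx)
  obtain ⟨m, μ, hμ, hm, he⟩ := hreg (-(f' xbar)) x r _ hx hr hv
    (fun k => ⟨l k, _, hN k, hK k, by abel⟩)
  refine ⟨m, ?_, hxK, hm⟩
  rw [he, add_sub_cancel_left]
  exact hμ
end

section
/- Let x̄ ∈ F be a feasible point of problem (P). If for every continuously Fréchet differentiable function f : X → ℝ the implication 'x̄ is an s-AKKT point of the problem with objective f ⇒ x̄ is a KKT point of the problem with objective f' holds, then x̄ is s-AKKT regular. -/
open Filter Topology MeasureTheory

theorem stmt_4 {X Y : Type*} [NormedAddCommGroup X] [NormedSpace ℝ X] [CompleteSpace X]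
    [NormedAddCommGroup Y] [NormedSpace ℝ Y] [CompleteSpace Y]
    (G : X → Y) (G' : X → X →L[ℝ] Y)
    (hGd : ∀ x, HasFDerivAt G (G' x) x) (hGc : Continuous G')
    (C : Set X) (K : Set Y)
    (hCne : C.Nonempty) (hCcl : IsClosed C) (hCcv : Convex ℝ C)
    (hKne : K.Nonempty) (hKcl : IsClosed K) (hKcv : Convex ℝ K)
    (xbar : X) (hxC : xbar ∈ C) (hxK : G xbar ∈ K)
    (himp : ∀ (f : X → ℝ) (f' : X → X →L[ℝ] ℝ),
      (∀ x, HasFDerivAt f (f' x) x) → Continuous f' →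
      sAKKTPoint f' G G' C K xbar → KKTPoint f' G G' C K xbar) :
    sAKKTRegular G G' C K xbar := by
  intro v0 x r v hx hr hv hM
  choose l μ hμ hl hvk using hM
  obtain ⟨l0, h1, h2⟩ := himp (fun z => (-v0) z) (fun _ => -v0)
    (fun z => (-v0).hasFDerivAt) continuous_const
    ⟨x, l, fun k => v k - v0, r, by simpa using hv.sub_const v0, hr, fun k => by
      have h : v k - v0 - -v0 - (l k).comp (G' (x k)) = μ k := by
        rw [hvk k]; abel
      rw [h]; exact hμ k, hl, hx⟩
  exact ⟨l0, _, h1, h2.2, by simp⟩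
end

section
/- Let x̄ ∈ F be a feasible point of problem (P) and suppose that f' : X → X* is weak-to-weak* sequentially continuous. If x̄ is a w-AKKT point and x̄ is w-AKKT regular, then x̄ is a KKT point of (P). -/
open Filter Topology MeasureTheory

theorem stmt_5 {X Y : Type*} [NormedAddCommGroup X] [NormedSpace ℝ X] [CompleteSpace X]
    [NormedAddCommGroup Y] [NormedSpace ℝ Y] [CompleteSpace Y]
    (f : X → ℝ) (f' : X → X →L[ℝ] ℝ)
    (hfd : ∀ x, HasFDerivAt f (f' x) x) (hfc : Continuous f')
    (hfw : ∀ (x : ℕ → X) (z : X), WeakSeqConv x z →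
      WeakStarSeqConv (fun k => f' (x k)) (f' z))
    (G : X → Y) (G' : X → X →L[ℝ] Y)
    (hGd : ∀ x, HasFDerivAt G (G' x) x) (hGc : Continuous G')
    (C : Set X) (K : Set Y)
    (hCne : C.Nonempty) (hCcl : IsClosed C) (hCcv : Convex ℝ C)
    (hKne : K.Nonempty) (hKcl : IsClosed K) (hKcv : Convex ℝ K)
    (xbar : X) (hxC : xbar ∈ C) (hxK : G xbar ∈ K)
    (hpt : wAKKTPoint f' G G' C K xbar)
    (hreg : wAKKTRegular G G' C K xbar) :
    KKTPoint f' G G' C K xbar := by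
  obtain ⟨x, l, ε, r, hε, hr, hN, hK, hx⟩ := hpt
  have hv : WeakStarSeqConv (fun k => ε k - f' (x k)) (-(f' xbar)) := by
    intro z
    have h := (hε z).sub (hfw x xbar hx z)
    simpa using h
  obtain ⟨lb, μ, hμ, hl, he⟩ := hreg _ x r _ hx hr hv
    (fun k => ⟨l k, _, hN k, hK k, by abel⟩)
  refine ⟨lb, ?_, hxK, hl⟩
  rw [he, add_sub_cancel_left]
  exact hμ
end

section
/- Let x̄ ∈ F be a feasible point of problem (P). If for every continuously Fréchet differentiable function f : X → ℝ the implication 'x̄ is a w-AKKT point of the problem with objective f ⇒ x̄ is a KKT point of the problem with objective f' holds, then x̄ is w-AKKT regular. -/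
open Filter Topology MeasureTheory

theorem stmt_6 {X Y : Type*} [NormedAddCommGroup X] [NormedSpace ℝ X] [CompleteSpace X]
    [NormedAddCommGroup Y] [NormedSpace ℝ Y] [CompleteSpace Y]
    (G : X → Y) (G' : X → X →L[ℝ] Y)
    (hGd : ∀ x, HasFDerivAt G (G' x) x) (hGc : Continuous G')
    (C : Set X) (K : Set Y)
    (hCne : C.Nonempty) (hCcl : IsClosed C) (hCcv : Convex ℝ C)
    (hKne : K.Nonempty) (hKcl : IsClosed K) (hKcv : Convex ℝ K)
    (xbar : X) (hxC : xbar ∈ C) (hxK : G xbar ∈ K)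
    (himp : ∀ (f : X → ℝ) (f' : X → X →L[ℝ] ℝ),
      (∀ x, HasFDerivAt f (f' x) x) → Continuous f' →
      wAKKTPoint f' G G' C K xbar → KKTPoint f' G G' C K xbar) :
    wAKKTRegular G G' C K xbar := by
  intro v0 x r v hx hr hv hM
  choose l μ hμ hl hvk using hM
  have hW : wAKKTPoint (fun _ => -v0) G G' C K xbar := by
    refine ⟨x, l, fun k => v k - v0, r, ?_, hr, ?_, hl, hx⟩
    · intro z
      have h := (hv z).sub_const (v0 z)
      simpa using h
    · intro k
      have h : v k - v0 - -v0 - (l k).comp (G' (x k)) = μ k := by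
        rw [hvk k]; abel
      show v k - v0 - -v0 - (l k).comp (G' (x k)) ∈ normalCone C (x k)
      rw [h]
      exact hμ k
  obtain ⟨l0, h1, h2⟩ := himp (fun z => (-v0) z) (fun _ => -v0)
    (fun z => (-v0).hasFDerivAt) continuous_const hW
  refine ⟨l0, _, h1, h2.2, ?_⟩
  show v0 = l0.comp (G' xbar) + (- -v0 - l0.comp (G' xbar))
  abel
end

section
/- Let x̄ ∈ F be a feasible point of problem (P). Assume that for all sequences {x^k} ⊂ X, {r^k} ⊂ [0,∞), {v^k} ⊂ X* satisfying x^k → x̄ in norm, r^k ↓ 0, v^k →* v̄ in the weak-* topology for some v̄ ∈ X*, and v^k ∈ M(x^k, r^k) for all k, there exist norm-bounded sequences {λ^k} ⊂ Y* and {μ^k} ⊂ X* such that μ^k ∈ N_C(x^k), ⟨λ^k, y − G(x^k)⟩ ≤ r^k for all y ∈ K and all k, and v^k = G'(x^k)*λ^k + μ^k for all k. Then x̄ is sw-AKKT regular. -/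
open Filter Topology MeasureTheory

/-- Banach-Alaoglu along an ultrafilter. -/
theorem aux_alaoglu {Z : Type*} [NormedAddCommGroup Z] [NormedSpace ℝ Z]
    (U : Ultrafilter ℕ) (l : ℕ → Z →L[ℝ] ℝ) (M : ℝ) (h : ∀ k, ‖l k‖ ≤ M) :
    ∃ l0 : Z →L[ℝ] ℝ, ∀ z, Tendsto (fun k => l k z) U (𝓝 (l0 z)) := by
  have hc := WeakDual.isCompact_closedBall (𝕜 := ℝ) (0 : StrongDual ℝ Z) M
  let w : ℕ → WeakDual ℝ Z := fun k => StrongDual.toWeakDual (l k)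
  have hw : ∀ k, w k ∈ WeakDual.toStrongDual ⁻¹' Metric.closedBall (0 : StrongDual ℝ Z) M := by
    intro k
    have : (l k : StrongDual ℝ Z) ∈ Metric.closedBall (0 : StrongDual ℝ Z) M := by
      rw [mem_closedBall_zero_iff]
      exact h k
    exact this
  obtain ⟨w0, -, hw0⟩ := hc.ultrafilter_le_nhds (U.map w) (by
    rw [le_principal_iff]
    exact Filter.mem_map.2 (Filter.univ_mem' hw))
  refine ⟨WeakDual.toStrongDual w0, fun z => ?_⟩
  have ht : Tendsto w U (𝓝 w0) := hw0
  exact ((WeakDual.eval_continuous z).tendsto w0).comp ht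

theorem aux_joint {Z : Type*} [NormedAddCommGroup Z] [NormedSpace ℝ Z]
    (U : Filter ℕ) (l : ℕ → Z →L[ℝ] ℝ) (M : ℝ) (h : ∀ k, ‖l k‖ ≤ M)
    (l0 : Z →L[ℝ] ℝ) (hl : ∀ z, Tendsto (fun k => l k z) U (𝓝 (l0 z)))
    (z : ℕ → Z) (z0 : Z) (hz : Tendsto z U (𝓝 z0)) :
    Tendsto (fun k => l k (z k)) U (𝓝 (l0 z0)) := by
  have h1 : Tendsto (fun k => M * ‖z k - z0‖) U (𝓝 0) := by
    have := (tendsto_iff_norm_sub_tendsto_zero.1 hz).const_mul M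
    simpa using this
  have h2 : Tendsto (fun k => l k (z k - z0)) U (𝓝 0) :=
    squeeze_zero_norm (fun k => (l k).le_of_opNorm_le (h k) _) h1
  have h3 := h2.add (hl z0)
  simpa using h3

theorem stmt_8 {X Y : Type*} [NormedAddCommGroup X] [NormedSpace ℝ X] [CompleteSpace X]
    [NormedAddCommGroup Y] [NormedSpace ℝ Y] [CompleteSpace Y]
    (G : X → Y) (G' : X → X →L[ℝ] Y)
    (hGd : ∀ x, HasFDerivAt G (G' x) x) (hGc : Continuous G')
    (C : Set X) (K : Set Y)
    (hCne : C.Nonempty) (hCcl : IsClosed C) (hCcv : Convex ℝ C)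
    (hKne : K.Nonempty) (hKcl : IsClosed K) (hKcv : Convex ℝ K)
    (xbar : X) (hxC : xbar ∈ C) (hxK : G xbar ∈ K)
    (hbdd : ∀ (x : ℕ → X) (r : ℕ → ℝ) (v : ℕ → X →L[ℝ] ℝ) (v0 : X →L[ℝ] ℝ),
      Tendsto x atTop (𝓝 xbar) → DownTo0 r → WeakStarSeqConv v v0 →
      (∀ k, v k ∈ Mset G G' C K (x k) (r k)) →
      ∃ (l : ℕ → Y →L[ℝ] ℝ) (μ : ℕ → X →L[ℝ] ℝ) (M : ℝ),
        (∀ k, ‖l k‖ ≤ M) ∧ (∀ k, ‖μ k‖ ≤ M) ∧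
        (∀ k, μ k ∈ normalCone C (x k)) ∧
        (∀ k, ∀ y ∈ K, (l k) (y - G (x k)) ≤ r k) ∧
        (∀ k, v k = (l k).comp (G' (x k)) + μ k)) :
    swAKKTRegular G G' C K xbar := by
  intro v0 x r v hx hr hv hm
  obtain ⟨l, μ, M, hl, hμ, hμC, hlK, hvk⟩ := hbdd x r v v0 hx hr hv hm
  let U : Ultrafilter ℕ := hyperfilter ℕ
  have hU : (U : Filter ℕ) ≤ atTop := Nat.hyperfilter_le_atTop
  obtain ⟨l0, hl0⟩ := aux_alaoglu U l M hl
  obtain ⟨μ0, hμ0⟩ := aux_alaoglu U μ M hμ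
  have hxU := hx.mono_left hU
  refine ⟨l0, μ0, ⟨hxC, fun z hz => ?_⟩, fun y hy => ?_, ?_⟩
  · exact le_of_tendsto (aux_joint U μ M hμ μ0 hμ0 (fun k => z - x k) (z - xbar)
      (tendsto_const_nhds.sub hxU)) (Eventually.of_forall fun k => (hμC k).2 z hz)
  · have hG : Tendsto (fun k => G (x k)) U (𝓝 (G xbar)) :=
      ((hGd xbar).continuousAt.tendsto).comp hxU
    exact le_of_tendsto_of_tendsto (aux_joint U l M hl l0 hl0 (fun k => y - G (x k)) (y - G xbar)
      (tendsto_const_nhds.sub hG)) (hr.2.2.mono_left hU)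
      (Eventually.of_forall fun k => hlK k y hy)
  · ext z
    have hG : Tendsto (fun k => G' (x k) z) U (𝓝 (G' xbar z)) :=
      ((hGc.clm_apply continuous_const).tendsto xbar).comp hxU
    have h1 := (aux_joint U l M hl l0 hl0 _ _ hG).add (hμ0 z)
    refine tendsto_nhds_unique ((hv z).mono_left hU) ?_
    simpa [hvk] using h1
end

section
/- Let x̄ ∈ F be a feasible point of problem (P) with C = X, and suppose that G : X → Y and G' : X → L(X,Y) are completely continuous. Assume that for all sequences {x^k} ⊂ X, {r^k} ⊂ [0,∞), {v^k} ⊂ X* satisfying x^k ⇀ x̄ weakly, r^k ↓ 0, v^k →* v̄ in the weak-* topology for some v̄ ∈ X*, and v^k ∈ M(x^k, r^k) for all k, there exists a norm-bounded sequence {λ^k} ⊂ Y* such that ⟨λ^k, y − G(x^k)⟩ ≤ r^k for all y ∈ K and all k, and v^k = G'(x^k)*λ^k for all k. Then x̄ is w-AKKT regular. -/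
open Filter Topology MeasureTheory

/-- A bounded sequence of functionals converges pointwise along some ultrafilter. -/
theorem aux_ultra {Y : Type*} [NormedAddCommGroup Y] [NormedSpace ℝ Y]
    (l : ℕ → Y →L[ℝ] ℝ) (M : ℝ) (hM : ∀ k, ‖l k‖ ≤ M) :
    ∃ l0 : Y →L[ℝ] ℝ, ∀ y : Y,
      Tendsto (fun k => l k y) (hyperfilter ℕ : Filter ℕ) (𝓝 (l0 y)) := by
  have hc := WeakDual.isCompact_closedBall (𝕜 := ℝ) (E := Y) 0 M
  let w : ℕ → WeakDual ℝ Y := fun k => StrongDual.toWeakDual (l k)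
  have hmem : ∀ k, w k ∈ (WeakDual.toStrongDual ⁻¹' Metric.closedBall (0 : StrongDual ℝ Y) M) := by
    intro k
    simpa [w] using hM k
  obtain ⟨a, -, ha⟩ := hc.ultrafilter_le_nhds ((hyperfilter ℕ).map w) (by
    rw [le_principal_iff]
    exact Filter.mem_map.2 (Filter.univ_mem' hmem))
  refine ⟨WeakDual.toStrongDual a, fun y => ?_⟩
  have ht : Tendsto w (hyperfilter ℕ : Filter ℕ) (𝓝 a) := ha
  exact ((WeakDual.eval_continuous y).tendsto a).comp ht

/-- Bounded pointwise limits pair well with norm-convergent sequences. -/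
theorem aux_pair {Y : Type*} [NormedAddCommGroup Y] [NormedSpace ℝ Y]
    (l : ℕ → Y →L[ℝ] ℝ) (M : ℝ) (hM : ∀ k, ‖l k‖ ≤ M) (F : Filter ℕ) (l0 : Y →L[ℝ] ℝ)
    (hl : ∀ y : Y, Tendsto (fun k => l k y) F (𝓝 (l0 y)))
    (y : ℕ → Y) (y0 : Y) (hy : Tendsto y F (𝓝 y0)) :
    Tendsto (fun k => l k (y k)) F (𝓝 (l0 y0)) := by
  have h1 : Tendsto (fun k => l k (y k - y0)) F (𝓝 0) := by
    have h2 : Tendsto (fun k => M * ‖y k - y0‖) F (𝓝 0) := by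
      have := (tendsto_iff_norm_sub_tendsto_zero.1 hy).const_mul M
      simpa using this
    exact squeeze_zero_norm (fun k => (l k).le_of_opNorm_le (hM k) _) h2
  have h3 := h1.add (hl y0)
  simpa using h3

theorem stmt_9 {X Y : Type*} [NormedAddCommGroup X] [NormedSpace ℝ X] [CompleteSpace X]
    [NormedAddCommGroup Y] [NormedSpace ℝ Y] [CompleteSpace Y]
    (G : X → Y) (G' : X → X →L[ℝ] Y)
    (hGd : ∀ x, HasFDerivAt G (G' x) x) (hGc : Continuous G')
    (K : Set Y) (hKne : K.Nonempty) (hKcl : IsClosed K) (hKcv : Convex ℝ K)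
    (xbar : X) (hxK : G xbar ∈ K)
    (hGcc : ∀ (x : ℕ → X) (z : X), WeakSeqConv x z →
      Tendsto (fun k => G (x k)) atTop (𝓝 (G z)))
    (hG'cc : ∀ (x : ℕ → X) (z : X), WeakSeqConv x z →
      Tendsto (fun k => G' (x k)) atTop (𝓝 (G' z)))
    (hbdd : ∀ (x : ℕ → X) (r : ℕ → ℝ) (v : ℕ → X →L[ℝ] ℝ) (v0 : X →L[ℝ] ℝ),
      WeakSeqConv x xbar → DownTo0 r → WeakStarSeqConv v v0 →
      (∀ k, v k ∈ Mset G G' Set.univ K (x k) (r k)) →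
      ∃ (l : ℕ → Y →L[ℝ] ℝ) (M : ℝ),
        (∀ k, ‖l k‖ ≤ M) ∧
        (∀ k, ∀ y ∈ K, (l k) (y - G (x k)) ≤ r k) ∧
        (∀ k, v k = (l k).comp (G' (x k)))) :
    wAKKTRegular G G' Set.univ K xbar := by
  intro v0 x r v hx hr hv hmem
  obtain ⟨l, M, hM, hK, hvl⟩ := hbdd x r v v0 hx hr hv hmem
  obtain ⟨l0, hl0⟩ := aux_ultra l M hM
  have hle : (hyperfilter ℕ : Filter ℕ) ≤ atTop := Nat.hyperfilter_le_atTop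
  refine ⟨l0, 0, ⟨Set.mem_univ _, fun z _ => by simp⟩, fun y hy => ?_, ?_⟩
  · have h1 : Tendsto (fun k => y - G (x k)) (hyperfilter ℕ : Filter ℕ) (𝓝 (y - G xbar)) :=
      ((hGcc x xbar hx).mono_left hle).const_sub y
    exact le_of_tendsto_of_tendsto' (aux_pair l M hM _ l0 hl0 _ _ h1)
      (hr.2.2.mono_left hle) (fun k => hK k y hy)
  · ext z
    have h1 : Tendsto (fun k => G' (x k) z) (hyperfilter ℕ : Filter ℕ) (𝓝 (G' xbar z)) :=
      ((ContinuousLinearMap.apply ℝ Y z).continuous.tendsto _).comp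
        ((hG'cc x xbar hx).mono_left hle)
    have h2 := aux_pair l M hM _ l0 hl0 _ _ h1
    have h3 : Tendsto (fun k => l k (G' (x k) z)) (hyperfilter ℕ : Filter ℕ) (𝓝 (v0 z)) := by
      refine ((hv z).mono_left hle).congr fun k => ?_
      rw [hvl k]; rfl
    simpa using tendsto_nhds_unique h3 h2
end

section
/- Assume that Robinson's constraint qualification is satisfied at a feasible point x̄ ∈ F of problem (P), that C = X, and that G : X → Y and G' : X → L(X,Y) are completely continuous. Then x̄ is w-AKKT regular. -/
open Filter Topology MeasureTheory

theorem stmt_11 {X Y : Type*} [NormedAddCommGroup X] [NormedSpace ℝ X] [CompleteSpace X]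
    [NormedAddCommGroup Y] [NormedSpace ℝ Y] [CompleteSpace Y]
    (G : X → Y) (G' : X → X →L[ℝ] Y)
    (hGd : ∀ x, HasFDerivAt G (G' x) x) (hGc : Continuous G')
    (K : Set Y) (hKne : K.Nonempty) (hKcl : IsClosed K) (hKcv : Convex ℝ K)
    (xbar : X) (hxK : G xbar ∈ K)
    (hGcc : ∀ (x : ℕ → X) (z : X), WeakSeqConv x z →
      Tendsto (fun k => G (x k)) atTop (𝓝 (G z)))
    (hG'cc : ∀ (x : ℕ → X) (z : X), WeakSeqConv x z →
      Tendsto (fun k => G' (x k)) atTop (𝓝 (G' z)))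
    (hRCQ : ∀ y : Y, ∃ d : X, ∃ w ∈ radialCone K (G xbar), y = G' xbar d - w) :
    wAKKTRegular G G' Set.univ K xbar := by
  intro v0 x r v hx hr hv hM
  have hG := hGcc x xbar hx
  have hG' := hG'cc x xbar hx
  have hM' : ∀ k, ∃ l : Y →L[ℝ] ℝ, (∀ y ∈ K, l (y - G (x k)) ≤ r k) ∧
      v k = l.comp (G' (x k)) := by
    intro k
    obtain ⟨l, μ, ⟨_, hμ⟩, hl, hvk⟩ := hM k
    refine ⟨l, hl, ?_⟩
    have : μ = 0 := by
      ext z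
      have h1 := hμ (x k + z) (Set.mem_univ _)
      have h2 := hμ (x k - z) (Set.mem_univ _)
      have e2 : x k - z - x k = -z := by abel
      rw [add_sub_cancel_left] at h1
      rw [e2, map_neg] at h2
      simp only [ContinuousLinearMap.zero_apply]
      linarith
    rw [hvk, this, add_zero]
  choose l hl hvl using hM'
  obtain ⟨hr0, hranti, hrlim⟩ := hr
  -- the functionals `v k` are bounded
  obtain ⟨M, hMb⟩ : ∃ M, ∀ k, ‖v k‖ ≤ M := by
    apply banach_steinhaus
    intro z
    obtain ⟨c, hc⟩ := (hv z).norm.bddAbove_range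
    exact ⟨c, fun k => hc ⟨k, rfl⟩⟩
  have hM0 : 0 ≤ M := (norm_nonneg _).trans (hMb 0)
  let e : ℕ → ℝ := fun k => ‖G (x k) - G xbar‖ + ‖G' (x k) - G' xbar‖
  have he0 : ∀ k, 0 ≤ e k := fun k => by positivity
  have helim : Tendsto e atTop (𝓝 0) := by
    have h1 := (tendsto_iff_norm_sub_tendsto_zero.1 hG)
    have h2 := (tendsto_iff_norm_sub_tendsto_zero.1 hG')
    simpa using h1.add h2
  have hK : ∀ k, ∀ z ∈ K, l k (z - G xbar) ≤ r k + ‖l k‖ * e k := by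
    intro k z hz
    have h1 := hl k z hz
    have h2 : l k (G (x k) - G xbar) ≤ ‖l k‖ * ‖G (x k) - G xbar‖ :=
      (le_abs_self _).trans ((l k).le_opNorm _)
    have h3 : ‖l k‖ * ‖G (x k) - G xbar‖ ≤ ‖l k‖ * e k := by
      apply mul_le_mul_of_nonneg_left _ (norm_nonneg _)
      simp only [e]; linarith [norm_nonneg (G' (x k) - G' xbar)]
    have h4 : z - G xbar = (z - G (x k)) + (G (x k) - G xbar) := by abel
    rw [h4, map_add]; linarith
  have hA : ∀ k d, |l k (G' xbar d) - v k d| ≤ ‖l k‖ * e k * ‖d‖ := by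
    intro k d
    have h1 : l k (G' xbar d) - v k d = - l k ((G' (x k) - G' xbar) d) := by
      rw [hvl k]; simp
    rw [h1, abs_neg]
    have h2 : |l k ((G' (x k) - G' xbar) d)| ≤ ‖l k‖ * ‖(G' (x k) - G' xbar) d‖ :=
      (l k).le_opNorm _
    have h3 := (G' (x k) - G' xbar).le_opNorm d
    have h4 : ‖G' (x k) - G' xbar‖ ≤ e k := by
      simp only [e]; linarith [norm_nonneg (G (x k) - G xbar)]
    calc _ ≤ _ := h2
      _ ≤ ‖l k‖ * (e k * ‖d‖) := by gcongr; exact h3.trans (by gcongr)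
      _ = _ := by ring
  have hone : ∀ k, 0 < 1 + ‖l k‖ * e k := fun k => by
    have := mul_nonneg (norm_nonneg (l k)) (he0 k); linarith
  -- pointwise one-sided bound
  have hpt : ∀ y : Y, ∃ c, ∀ k, l k (-y) ≤ c * (1 + ‖l k‖ * e k) := by
    intro y
    obtain ⟨d, w, ⟨α, hα, z, hz, rfl⟩, rfl⟩ := hRCQ y
    refine ⟨(M + 1) * ‖d‖ + α * (r 0 + 1), fun k => ?_⟩
    have h1 := mul_le_mul_of_nonneg_left (hK k z hz) hα
    have h2 := (abs_le.1 (hA k d)).1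
    have h3 : -(v k d) ≤ M * ‖d‖ :=
      (neg_le_abs _).trans (((v k).le_opNorm d).trans
        (mul_le_mul_of_nonneg_right (hMb k) (norm_nonneg _)))
    have h4 : r k ≤ r 0 := hranti (Nat.zero_le k)
    have h5 := mul_nonneg (norm_nonneg (l k)) (he0 k)
    have h6 := mul_le_mul_of_nonneg_left h4 hα
    have h7 : 0 ≤ M * ‖d‖ := by positivity
    have h8 : 0 ≤ α * r 0 := mul_nonneg hα (hr0 0)
    have h9 := norm_nonneg d
    rw [map_neg, map_sub, map_smul, smul_eq_mul]
    generalize ‖l k‖ * e k = s at *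
    nlinarith [mul_nonneg h7 h5, mul_nonneg h8 h5]
  obtain ⟨B, hB⟩ : ∃ B, ∀ k, ‖(1 + ‖l k‖ * e k)⁻¹ • l k‖ ≤ B := by
    apply banach_steinhaus
    intro y
    obtain ⟨c1, h1⟩ := hpt y
    obtain ⟨c2, h2⟩ := hpt (-y)
    refine ⟨max c1 c2, fun k => ?_⟩
    have h1 := h1 k
    have h2 := h2 k
    rw [map_neg] at h1
    rw [neg_neg] at h2
    rw [ContinuousLinearMap.smul_apply, norm_smul, norm_inv, Real.norm_of_nonneg (hone k).le,
      inv_mul_le_iff₀ (hone k), mul_comm, Real.norm_eq_abs, abs_le]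
    have h3 := mul_le_mul_of_nonneg_right (le_max_left c1 c2) (hone k).le
    have h4 := mul_le_mul_of_nonneg_right (le_max_right c1 c2) (hone k).le
    constructor <;> linarith
  have hlB : ∀ k, ‖l k‖ ≤ B * (1 + ‖l k‖ * e k) := by
    intro k
    have h := hB k
    rwa [norm_smul, norm_inv, Real.norm_of_nonneg (hone k).le,
      inv_mul_le_iff₀ (hone k), mul_comm] at h
  have hev : ∀ᶠ k in atTop, ‖l k‖ ≤ 2 * B := by
    have h1 : Tendsto (fun k => B * e k) atTop (𝓝 0) := by simpa using helim.const_mul B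
    filter_upwards [h1.eventually (gt_mem_nhds (show (0:ℝ) < 1 / 2 by norm_num))] with k hk
    have := hlB k
    nlinarith [norm_nonneg (l k)]
  -- weak-* cluster point
  let U : Ultrafilter ℕ := Filter.hyperfilter ℕ
  have hU : (U : Filter ℕ) ≤ atTop := Nat.hyperfilter_le_atTop
  have hevU := hU hev
  obtain ⟨L, _, hL⟩ := (WeakDual.isCompact_closedBall (𝕜 := ℝ) (0 : StrongDual ℝ Y)
      (2 * B)).ultrafilter_le_nhds (U.map fun k => StrongDual.toWeakDual (l k)) (by
    rw [Ultrafilter.coe_map, Filter.le_principal_iff, Filter.mem_map]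
    filter_upwards [hevU] with k hk
    simpa using hk)
  have hLy : ∀ y : Y, Tendsto (fun k => l k y) U (𝓝 (WeakDual.toStrongDual L y)) := by
    intro y
    have h1 : Tendsto (fun k => StrongDual.toWeakDual (l k)) U (𝓝 L) := hL
    exact ((WeakDual.eval_continuous y).tendsto L).comp h1
  have hle : Tendsto (fun k => ‖l k‖ * e k) U (𝓝 0) := by
    have h1 : Tendsto (fun k => 2 * B * e k) U (𝓝 0) := by
      simpa using (helim.mono_left hU).const_mul (2 * B)
    refine squeeze_zero' (Eventually.of_forall fun k => mul_nonneg (norm_nonneg _) (he0 k)) ?_ h1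
    filter_upwards [hevU] with k hk
    exact mul_le_mul_of_nonneg_right hk (he0 k)
  refine ⟨WeakDual.toStrongDual L, 0, ⟨Set.mem_univ _, by simp⟩, ?_, ?_⟩
  · intro y hy
    have h1 := (hrlim.mono_left hU).add hle
    rw [add_zero] at h1
    exact le_of_tendsto_of_tendsto' (hLy _) h1 fun k => hK k y hy
  · rw [add_zero]
    ext d
    have h1 : Tendsto (fun k => l k (G' xbar d) - v k d) U (𝓝 0) := by
      have h2 := hle.mul_const ‖d‖
      rw [zero_mul] at h2
      exact squeeze_zero_norm (fun k => hA k d) h2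
    have h3 := (hLy (G' xbar d)).sub ((hv d).mono_left hU)
    have h4 := tendsto_nhds_unique h3 h1
    rw [ContinuousLinearMap.comp_apply]
    linarith
end
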